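/- Fix α > 0 and β > 0, and let h(x) := (log Γ(x+1))/x. Then there exists an integer N(α,β) ≥ 2 such that for every integer n ≥ 2, the inequality β < (log n)/(log n + h(α) − h(nα)) holds if and only if n ≥ N(α,β). -/

import Mathlib

open Real

/-- `h x = log Γ(x+1) / x`. -/
noncomputable def hGamma (x : ℝ) : ℝ := Real.log (Real.Gamma (x + 1)) / x

open Filter Topology Set Finset

/-- The partial sums `∑_{m=1}^N log (1 + x / m)`, with `log Γ(x+1) = lim (x log N - logSum N x)`. -/
noncomputable def logSum (N : ℕ) (x : ℝ) : ℝ :=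
  ∑ m ∈ range N, (Real.log (x + (m + 1)) - Real.log (m + 1))

/-- `∑_{m=1}^N 1 / (x + m) ^ k`. -/
noncomputable def shiftedPowSum (k N : ℕ) (x : ℝ) : ℝ :=
  ∑ m ∈ range N, 1 / (x + (m + 1)) ^ k

lemma tendsto_logSum {x : ℝ} (hx : 0 < x) :
    Tendsto (fun N : ℕ => x * Real.log N - logSum N x) atTop
      (𝓝 (Real.log (Real.Gamma (x + 1)))) := by
  have h := (Real.BohrMollerup.tendsto_log_gamma hx).add_const (Real.log x)
  rw [Real.Gamma_add_one hx.ne', Real.log_mul hx.ne' (Real.Gamma_pos_of_pos hx).ne', add_comm]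
  refine h.congr fun N => ?_
  have hfac : Real.log (N.factorial : ℝ) = ∑ m ∈ range N, Real.log ((m : ℝ) + 1) := by
    induction N with
    | zero => simp
    | succ N ih =>
      rw [sum_range_succ, ← ih, Nat.factorial_succ, Nat.cast_mul,
        Real.log_mul (by positivity) (by positivity)]
      push_cast
      ring
  rw [Real.BohrMollerup.logGammaSeq, logSum, sum_sub_distrib, ← hfac, sum_range_succ']
  push_cast
  simp only [add_zero]
  ring

lemma tendsto_hGamma {x : ℝ} (hx : 0 < x) :
    Tendsto (fun N : ℕ => Real.log N - logSum N x / x) atTop (𝓝 (hGamma x)) := by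
  refine ((tendsto_logSum hx).div_const x).congr fun N => ?_
  field_simp

lemma hasDerivAt_logSum (N : ℕ) {x : ℝ} (hx : 0 ≤ x) :
    HasDerivAt (logSum N) (shiftedPowSum 1 N x) x := by
  unfold logSum shiftedPowSum
  refine HasDerivAt.fun_sum fun m _ => ?_
  have hy : x + ((m : ℝ) + 1) ≠ 0 := by positivity
  simpa using (((hasDerivAt_id x).add_const ((m : ℝ) + 1)).log hy).sub_const (Real.log (m + 1))

lemma hasDerivAt_shiftedPowSum (k N : ℕ) {x : ℝ} (hx : 0 ≤ x) :
    HasDerivAt (shiftedPowSum k N) (-(k * shiftedPowSum (k + 1) N x)) x := by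
  unfold shiftedPowSum
  rw [mul_sum, ← sum_neg_distrib]
  refine HasDerivAt.fun_sum fun m _ => ?_
  have hy : x + ((m : ℝ) + 1) ≠ 0 := by positivity
  have h := (((hasDerivAt_id x).add_const ((m : ℝ) + 1)).pow k).inv (pow_ne_zero k hy)
  refine (h.congr_deriv ?_).congr_of_eventuallyEq (Eventually.of_forall fun z => by simp)
  rcases k with _ | k
  · simp
  · simp only [id, Pi.pow_apply, Nat.add_sub_cancel]
    field_simp
    ring

lemma shiftedPowSum_two_sub_three_ge (N : ℕ) {x : ℝ} (hx : 0 < x) :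
    -(N / ((x + N) * (x + N + 1))) ≤ shiftedPowSum 2 N x - 2 * x * shiftedPowSum 3 N x := by
  induction N with
  | zero => simp [shiftedPowSum]
  | succ N ih =>
    have step : (N : ℝ) / ((x + N) * (x + N + 1)) - (N + 1) / ((x + (N + 1)) * (x + (N + 1) + 1))
        ≤ 1 / (x + (N + 1)) ^ 2 - 2 * x * (1 / (x + (N + 1)) ^ 3) := by
      have hN : (0 : ℝ) ≤ N := N.cast_nonneg
      have hz : 0 < x + N := by positivity
      obtain ⟨z, hzdef⟩ : ∃ z, z = x + N := ⟨_, rfl⟩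
      have hNz : (N : ℝ) = z - x := by linarith
      have hxz : x ≤ z := by linarith
      have hz0 : 0 < z := by linarith
      have e1 : x + (N : ℝ) = z := hzdef.symm
      have e2 : x + ((N : ℝ) + 1) = z + 1 := by linarith
      rw [e1, e2, hNz, ← sub_nonneg]
      have : 1 / (z + 1) ^ 2 - 2 * x * (1 / (z + 1) ^ 3) - ((z - x) / (z * (z + 1)) -
          (z - x + 1) / ((z + 1) * (z + 1 + 1)))
          = (z * (z + 1) + 2 * x) / (z * (z + 1) ^ 3 * (z + 2)) := by
        field_simp
        ring
      rw [this]
      positivity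
    unfold shiftedPowSum at ih ⊢
    rw [sum_range_succ, sum_range_succ]
    push_cast
    linarith

/-- `x²` times the derivative of `x ↦ logSum N x / x - shiftedPowSum 1 N x + x / N` is nonnegative. -/
lemma logSum_curvature_nonneg {N : ℕ} (hN : 0 < N) {x : ℝ} (hx : 0 ≤ x) :
    0 ≤ x * shiftedPowSum 1 N x - logSum N x + x ^ 2 * shiftedPowSum 2 N x + x ^ 2 / N := by
  set B : ℝ → ℝ := fun x =>
    x * shiftedPowSum 1 N x - logSum N x + x ^ 2 * shiftedPowSum 2 N x + x ^ 2 / N with hB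
  have hd : ∀ y, 0 ≤ y → HasDerivAt B
      (y * (shiftedPowSum 2 N y - 2 * y * shiftedPowSum 3 N y + 2 / N)) y := by
    intro y hy
    have h := ((((hasDerivAt_id y).mul (hasDerivAt_shiftedPowSum 1 N hy)).sub
      (hasDerivAt_logSum N hy)).add (((hasDerivAt_id y).pow 2).mul
        (hasDerivAt_shiftedPowSum 2 N hy))).add (((hasDerivAt_id y).pow 2).div_const (N : ℝ))
    refine h.congr_deriv ?_
    simp
    ring
  have hmono : MonotoneOn B (Ici 0) := by
    refine monotoneOn_of_hasDerivWithinAt_nonneg (convex_Ici 0)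
      (fun y hy => (hd y hy).continuousAt.continuousWithinAt)
      (fun y hy => (hd y (interior_subset hy)).hasDerivWithinAt) fun y hy => ?_
    rw [interior_Ici] at hy
    have hy : 0 < y := hy
    have hN' : (0 : ℝ) < N := by exact_mod_cast hN
    have h1 := shiftedPowSum_two_sub_three_ge N hy
    have h2 : (N : ℝ) / ((y + N) * (y + N + 1)) ≤ 2 / N := by
      rw [div_le_div_iff₀ (by positivity) hN']
      nlinarith [mul_pos hy hN', mul_pos hy hy]
    exact mul_nonneg hy.le (by linarith)
  have h0 : B 0 = 0 := by simp [hB, logSum]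
  simpa [h0] using hmono (mem_Ici.2 le_rfl) (mem_Ici.2 hx) hx

lemma convexOn_logSum_exp {N : ℕ} (hN : 0 < N) :
    ConvexOn ℝ univ
      (fun t => Real.log N - logSum N (Real.exp t) / Real.exp t + Real.exp t / N) := by
  set p : ℝ → ℝ := fun x => logSum N x / x - shiftedPowSum 1 N x + x / N with hp
  have hpd : ∀ y, 0 < y → HasDerivAt p ((y * shiftedPowSum 1 N y - logSum N y +
      y ^ 2 * shiftedPowSum 2 N y + y ^ 2 / N) / y ^ 2) y := by
    intro y hy
    have h := (((hasDerivAt_logSum N hy.le).div (hasDerivAt_id y) hy.ne').sub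
      (hasDerivAt_shiftedPowSum 1 N hy.le)).add ((hasDerivAt_id y).div_const (N : ℝ))
    refine h.congr_deriv ?_
    simp
    field_simp
  have hpm : MonotoneOn p (Ioi 0) := by
    refine monotoneOn_of_hasDerivWithinAt_nonneg (convex_Ioi 0)
      (fun y hy => (hpd y hy).continuousAt.continuousWithinAt)
      (fun y hy => (hpd y (interior_subset hy)).hasDerivWithinAt) fun y hy => ?_
    exact div_nonneg (logSum_curvature_nonneg hN (le_of_lt (interior_subset hy))) (sq_nonneg y)
  have hd : ∀ t : ℝ, HasDerivAt
      (fun t => Real.log N - logSum N (Real.exp t) / Real.exp t + Real.exp t / N)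
      (p (Real.exp t)) t := by
    intro t
    have he := Real.hasDerivAt_exp t
    have h := ((((hasDerivAt_logSum N (Real.exp_pos t).le).comp t he).div he
      (Real.exp_pos t).ne').const_sub (Real.log N)).add (he.div_const (N : ℝ))
    refine h.congr_deriv ?_
    simp only [hp, Function.comp]
    field_simp
    ring
  refine Monotone.convexOn_univ_of_deriv (fun t => (hd t).differentiableAt) fun s t hst => ?_
  rw [(hd s).deriv, (hd t).deriv]
  exact hpm (Real.exp_pos s) (Real.exp_pos t) (Real.exp_le_exp.2 hst)

lemma convexOn_hGamma_exp : ConvexOn ℝ univ (fun t => hGamma (Real.exp t)) := by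
  have hlim : ∀ t : ℝ, Tendsto
      (fun N : ℕ => Real.log N - logSum N (Real.exp t) / Real.exp t + Real.exp t / N) atTop
      (𝓝 (hGamma (Real.exp t))) := by
    intro t
    simpa using (tendsto_hGamma (Real.exp_pos t)).add
      (tendsto_const_div_atTop_nhds_zero_nat (Real.exp t))
  refine ⟨convex_univ, fun s _ t _ a b ha hb hab => ?_⟩
  refine le_of_tendsto_of_tendsto (hlim _) (((hlim s).const_smul a).add ((hlim t).const_smul b)) ?_
  filter_upwards [eventually_gt_atTop 0] with N hN
  exact (convexOn_logSum_exp hN).2 (mem_univ s) (mem_univ t) ha hb hab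

/-- The secant slopes of `hGamma` in the logarithmic variable, based at `α`, are monotone. -/
lemma hGamma_slope_mono {α x y : ℝ} (hα : 0 < α) (hx : 1 < x) (hxy : x ≤ y) :
    (hGamma (x * α) - hGamma α) / Real.log x ≤ (hGamma (y * α) - hGamma α) / Real.log y := by
  have hx0 : 0 < x := by linarith
  have hy0 : 0 < y := by linarith
  have hlx : 0 < Real.log x := Real.log_pos hx
  have hly : 0 < Real.log y := Real.log_pos (by linarith)
  have hxy' : Real.log x ≤ Real.log y := Real.log_le_log hx0 hxy
  have h := convexOn_hGamma_exp.secant_mono (a := Real.log α) (x := Real.log α + Real.log x)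
    (y := Real.log α + Real.log y) (mem_univ _) (mem_univ _) (mem_univ _)
    (by linarith) (by linarith) (by linarith)
  simpa [Real.exp_add, Real.exp_log, hα, hx0, hy0, mul_comm α] using h

lemma mul_logSum_add_gap_le {α : ℝ} (hα : 0 < α) {n : ℕ} (hn : 2 ≤ n) {N : ℕ} (hN : 1 ≤ N) :
    n * logSum N α + (Real.log (1 + n * α) - Real.log (1 + α)) ≤ logSum (n * N) (n * α) := by
  have hn0 : (0 : ℝ) < n := by exact_mod_cast (by omega : 0 < n)
  have hterm : ∀ j i : ℕ, i < n → Real.log (α + (j + 1)) - Real.log (j + 1) ≤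
      Real.log (n * α + (((n * j + i : ℕ) : ℝ) + 1)) - Real.log (((n * j + i : ℕ) : ℝ) + 1) := by
    intro j i hi
    have hi' : (i : ℝ) + 1 ≤ n := by exact_mod_cast hi
    rw [← Real.log_div (by positivity) (by positivity),
      ← Real.log_div (by positivity) (by positivity)]
    refine Real.log_le_log (by positivity) ?_
    rw [div_le_div_iff₀ (by positivity) (by positivity)]
    push_cast
    nlinarith [mul_le_mul_of_nonneg_left hi' hα.le]
  have hblock : ∀ N, logSum (n * (N + 1)) (n * α) = logSum (n * N) (n * α) +
      ∑ i ∈ range n, (Real.log (n * α + (((n * N + i : ℕ) : ℝ) + 1)) -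
        Real.log (((n * N + i : ℕ) : ℝ) + 1)) := by
    intro N
    rw [mul_add, mul_one, logSum, sum_range_add, logSum]
  induction N, hN using Nat.le_induction with
  | base =>
    obtain ⟨k, rfl⟩ : ∃ k, n = k + 1 := ⟨n - 1, by omega⟩
    have hb := hblock 0
    rw [sum_range_succ'] at hb
    have hs : (k : ℝ) * (Real.log (α + 1)) ≤ ∑ i ∈ range k, (Real.log (((k + 1 : ℕ) : ℝ) * α +
        ((((k + 1) * 0 + (i + 1) : ℕ) : ℝ) + 1)) -
          Real.log ((((k + 1) * 0 + (i + 1) : ℕ) : ℝ) + 1)) := by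
      have := card_nsmul_le_sum (range k) _ (Real.log (α + 1)) fun i hi => by
        simpa using hterm 0 (i + 1) (by simpa using hi)
      simpa using this
    have h1 : logSum 1 α = Real.log (α + 1) := by simp [logSum]
    have h0 : logSum ((k + 1) * 0) (((k + 1 : ℕ) : ℝ) * α) = 0 := by simp [logSum]
    rw [h0] at hb
    rw [h1, show (k + 1) * 1 = (k + 1) * (0 + 1) by ring, hb]
    simp only [mul_zero, add_zero, Nat.cast_zero, zero_add, Real.log_one, sub_zero] at hs ⊢
    rw [add_comm 1 α, add_comm 1 (_ * α)]
    push_cast at hs ⊢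
    linarith
  | succ N hN ih =>
    have hs := card_nsmul_le_sum (range n) _ (Real.log (α + (N + 1)) - Real.log (N + 1))
      fun i hi => hterm N i (by simpa using hi)
    rw [card_range, nsmul_eq_mul] at hs
    rw [hblock]
    have : logSum (N + 1) α = logSum N α + (Real.log (α + (N + 1)) - Real.log (N + 1)) := by
      rw [logSum, sum_range_succ, logSum]
    rw [this]
    linarith

lemma hGamma_mul_lt {α : ℝ} (hα : 0 < α) {n : ℕ} (hn : 2 ≤ n) :
    hGamma (n * α) < Real.log n + hGamma α := by
  have hn2 : (2 : ℝ) ≤ n := by exact_mod_cast hn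
  have hn0 : (0 : ℝ) < n := by linarith
  set g := Real.log (1 + n * α) - Real.log (1 + α) with hg
  have hgpos : 0 < g := sub_pos.2 (Real.log_lt_log (by positivity) (by nlinarith))
  have h1 : Tendsto (fun N : ℕ => Real.log ((n * N : ℕ) : ℝ) - logSum (n * N) (n * α) / (n * α))
      atTop (𝓝 (hGamma (n * α))) :=
    (tendsto_hGamma (by positivity)).comp (tendsto_id.const_mul_atTop' (by omega : 0 < n))
  have h2 := (tendsto_hGamma hα).const_add (Real.log n - g / (n * α))
  have hle : hGamma (n * α) ≤ Real.log n - g / (n * α) + hGamma α := by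
    refine le_of_tendsto_of_tendsto h1 h2 ?_
    filter_upwards [eventually_ge_atTop 1] with N hN
    have hN0 : (0 : ℝ) < N := by exact_mod_cast hN
    have h := div_le_div_of_nonneg_right (mul_logSum_add_gap_le hα hn hN)
      (by positivity : 0 ≤ n * α)
    rw [add_div, mul_div_mul_left _ _ hn0.ne', ← hg] at h
    rw [Nat.cast_mul, Real.log_mul hn0.ne' hN0.ne']
    linarith
  have : 0 < g / (n * α) := by positivity
  linarith

lemma log_sub_one_le_hGamma {x : ℝ} (hx : 0 < x) : Real.log x - 1 ≤ hGamma x := by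
  have hint := Real.GammaIntegral_convergent (s := x + 1) (by linarith)
  have hsub : Ioi x ⊆ Ioi (0 : ℝ) := Ioi_subset_Ioi hx.le
  have hΓ : x ^ x * Real.exp (-x) ≤ Real.Gamma (x + 1) := by
    rw [Real.Gamma_eq_integral (by linarith)]
    calc x ^ x * Real.exp (-x) = ∫ t in Ioi x, x ^ x * Real.exp (-t) := by
          rw [MeasureTheory.integral_const_mul, integral_exp_neg_Ioi]
      _ ≤ ∫ t in Ioi x, Real.exp (-t) * t ^ (x + 1 - 1) := by
          refine MeasureTheory.setIntegral_mono_on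
            ((integrableOn_exp_neg_Ioi x).const_mul _) (hint.mono_set hsub) measurableSet_Ioi
            fun t ht => ?_
          rw [add_sub_cancel_right, mul_comm]
          exact mul_le_mul_of_nonneg_left (Real.rpow_le_rpow hx.le (le_of_lt ht) hx.le)
            (Real.exp_pos _).le
      _ ≤ ∫ t in Ioi 0, Real.exp (-t) * t ^ (x + 1 - 1) := by
          refine MeasureTheory.setIntegral_mono_set hint ?_ hsub.eventuallyLE
          filter_upwards [MeasureTheory.ae_restrict_mem measurableSet_Ioi] with t ht
          have ht : 0 < t := ht
          simp only [Pi.zero_apply]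
          positivity
  have h := Real.log_le_log (by positivity) hΓ
  rw [Real.log_mul (by positivity) (by positivity), Real.log_rpow hx, Real.log_exp] at h
  rw [hGamma, le_div_iff₀ hx]
  linarith

/-- For fixed `α, β > 0`, there exists `N(α,β) ≥ 2` such that for every `n ≥ 2`,
`β < log n / (log n + h(α) - h(nα))` holds if and only if `n ≥ N(α,β)`. -/
theorem exists_threshold (α β : ℝ) (hα : 0 < α) (hβ : 0 < β) :
    ∃ N : ℕ, 2 ≤ N ∧ ∀ n : ℕ, 2 ≤ n →
      (β < Real.log n / (Real.log n + hGamma α - hGamma (n * α)) ↔ N ≤ n) := by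
  classical
  have hpos : ∀ n : ℕ, 2 ≤ n → 0 < Real.log n + hGamma α - hGamma (n * α) :=
    fun n hn => sub_pos.2 (hGamma_mul_lt hα hn)
  have hex : ∃ n : ℕ, 2 ≤ n ∧ β < Real.log n / (Real.log n + hGamma α - hGamma (n * α)) := by
    have hlog := Real.tendsto_log_atTop.comp (tendsto_natCast_atTop_atTop (R := ℝ))
    obtain ⟨n, hn, hn2⟩ := ((hlog.eventually_gt_atTop
      (β * (hGamma α - Real.log α + 1))).and (eventually_ge_atTop 2)).exists
    refine ⟨n, hn2, ?_⟩
    have hn0 : (0 : ℝ) < n := by exact_mod_cast (by omega : 0 < n)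
    rw [lt_div_iff₀ (hpos n hn2)]
    refine lt_of_le_of_lt (mul_le_mul_of_nonneg_left ?_ hβ.le) hn
    have h := log_sub_one_le_hGamma (mul_pos hn0 hα)
    rw [Real.log_mul hn0.ne' hα.ne'] at h
    linarith
  refine ⟨Nat.find hex, (Nat.find_spec hex).1, fun n hn =>
    ⟨fun h => Nat.find_min' hex ⟨hn, h⟩, fun h => ?_⟩⟩
  obtain ⟨hm, hlt⟩ := Nat.find_spec hex
  set m := Nat.find hex
  have hm1 : (1 : ℝ) < m := by exact_mod_cast hm
  have hmn : (m : ℝ) ≤ n := by exact_mod_cast h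
  have hlm : 0 < Real.log m := Real.log_pos hm1
  have hln : 0 < Real.log n := Real.log_pos (by linarith)
  have hs := hGamma_slope_mono hα hm1 hmn
  refine hlt.trans_le ?_
  rw [div_le_div_iff₀ hlm hln] at hs
  rw [div_le_div_iff₀ (hpos m hm) (hpos n hn)]
  linarith
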